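/- arXiv:2212.04895 — 4 statements merged into one kernel-verified Lean document; each statement's English description precedes it below -/
import Mathlib

section
/- Let R be a finite set of n replicas, f a natural number with n ≥ 3f + 1, and B ⊆ R with |B| ≤ f (the Byzantine replicas). Let α be a type of transactions, and suppose each correct replica r ∈ R \ B is associated with a family 𝒞 r of finite subsets of α (the sets of debits it has signed) that is a chain under inclusion: any two members of 𝒞 r are comparable with respect to ⊆. If D and D' are finite subsets of α each having a quorum certificate — i.e., there exist Q, Q' ⊆ R with |Q| ≥ n − f and |Q'| ≥ n − f such that D ∈ 𝒞 r for every r ∈ Q \ B and D' ∈ 𝒞 r for every r ∈ Q' \ B — then D ⊆ D' or D' ⊆ D. -/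
/-- Any two quorums share a replica that is not Byzantine. -/
theorem exists_correct_mem_inter_of_quorums {α : Type*} [DecidableEq α]
    {R B Q Q' : Finset α} {f : ℕ} (hR : 3 * f + 1 ≤ R.card) (hB : B.card ≤ f)
    (hQR : Q ⊆ R) (hQ'R : Q' ⊆ R)
    (hQ : R.card - f ≤ Q.card) (hQ' : R.card - f ≤ Q'.card) :
    ∃ r ∈ Q ∩ Q', r ∉ B := by
  apply Finset.exists_mem_notMem_of_card_lt_card
  have hunion := Finset.card_le_card (Finset.union_subset hQR hQ'R)
  have hsum := Finset.card_union_add_card_inter Q Q'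
  omega

theorem prepared_sets_comparable {α β : Type*} [DecidableEq α]
    (R : Finset α) (n f : ℕ) (hR : R.card = n) (hnf : n ≥ 3 * f + 1)
    (B : Finset α) (hBR : B ⊆ R) (hB : B.card ≤ f)
    (𝒞 : α → Set (Finset β))
    (hchain : ∀ r ∈ R, r ∉ B → ∀ D ∈ 𝒞 r, ∀ D' ∈ 𝒞 r, D ⊆ D' ∨ D' ⊆ D)
    (D D' : Finset β)
    (Q Q' : Finset α) (hQR : Q ⊆ R) (hQ'R : Q' ⊆ R)
    (hQ : Q.card ≥ n - f) (hQ' : Q'.card ≥ n - f)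
    (hD : ∀ r ∈ Q, r ∉ B → D ∈ 𝒞 r)
    (hD' : ∀ r ∈ Q', r ∉ B → D' ∈ 𝒞 r) :
    D ⊆ D' ∨ D' ⊆ D := by
  subst hR
  obtain ⟨r, hr, hrB⟩ := exists_correct_mem_inter_of_quorums hnf hB hQR hQ'R hQ hQ'
  obtain ⟨hrQ, hrQ'⟩ := Finset.mem_inter.mp hr
  exact hchain r (hQR hrQ) hrB D (hD r hrQ hrB) D' (hD' r hrQ' hrB)
end

section
/- Let α be a type, v : α → ℝ a function with v x ≥ 0 for all x, and V : ℝ. Let I and P be finite subsets of α with ∑_{x ∈ I} v x ≤ V. Then there exists a finite set Sel with I ⊆ Sel ⊆ I ∪ P, ∑_{x ∈ Sel} v x ≤ V, and such that for every x ∈ P \ Sel, ∑_{y ∈ Sel ∪ {x}} v y > V. -/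
theorem extract_safe_transactions {α : Type*} [DecidableEq α]
    (v : α → ℝ) (hv : ∀ x, v x ≥ 0) (V : ℝ)
    (I P : Finset α) (hI : ∑ x ∈ I, v x ≤ V) :
    ∃ Sel : Finset α, I ⊆ Sel ∧ Sel ⊆ I ∪ P ∧ (∑ x ∈ Sel, v x ≤ V) ∧
      ∀ x ∈ P \ Sel, ∑ y ∈ Sel ∪ {x}, v y > V := by
  obtain ⟨S, hS, hmax⟩ := Finset.exists_max_image
    ((I ∪ P).powerset.filter fun S => I ⊆ S ∧ ∑ x ∈ S, v x ≤ V) Finset.card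
    ⟨I, Finset.mem_filter.mpr
      ⟨Finset.mem_powerset.mpr Finset.subset_union_left, Finset.Subset.refl I, hI⟩⟩
  simp only [Finset.mem_filter, Finset.mem_powerset] at hS hmax
  obtain ⟨hSP, hIS, hSV⟩ := hS
  refine ⟨S, hIS, hSP, hSV, fun x hx => ?_⟩
  obtain ⟨hxP, hxS⟩ := Finset.mem_sdiff.mp hx
  by_contra! hle
  have hsub : S ∪ {x} ⊆ I ∪ P :=
    Finset.union_subset hSP (Finset.singleton_subset_iff.mpr (Finset.mem_union_right I hxP))
  have hcard := hmax (S ∪ {x}) ⟨hsub, hIS.trans Finset.subset_union_left, hle⟩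
  rw [Finset.card_union_of_disjoint (Finset.disjoint_singleton_right.mpr hxS),
    Finset.card_singleton] at hcard
  omega
end

section
/- Let R be a finite set of n replicas, f a natural number with n ≥ 3f + 1, and B ⊆ R with |B| ≤ f (the Byzantine replicas). Let α be a type, and let store, reply : R → Finset α be such that store r ⊆ reply r for every correct replica r ∈ R \ B. Suppose a value v ∈ α was stored at a quorum: there exists Q ⊆ R with |Q| ≥ n − f such that v ∈ store r for every r ∈ Q \ B. Then for every Q' ⊆ R with |Q'| ≥ n − f, v belongs to the union ⋃_{r ∈ Q'} reply r. -/
theorem storage_read_consistency {ρ α : Type*} [DecidableEq ρ] [DecidableEq α]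
    (R : Finset ρ) (n f : ℕ) (hR : R.card = n) (hnf : n ≥ 3 * f + 1)
    (B : Finset ρ) (hBR : B ⊆ R) (hB : B.card ≤ f)
    (store reply : ρ → Finset α)
    (hmono : ∀ r ∈ R, r ∉ B → store r ⊆ reply r)
    (v : α)
    (Q : Finset ρ) (hQR : Q ⊆ R) (hQ : Q.card ≥ n - f)
    (hstored : ∀ r ∈ Q, r ∉ B → v ∈ store r) :
    ∀ Q' : Finset ρ, Q' ⊆ R → Q'.card ≥ n - f → v ∈ Q'.biUnion reply := by
  intro Q' hQ'R hQ'
  have hunion : (Q ∪ Q').card ≤ R.card := Finset.card_le_card (Finset.union_subset hQR hQ'R)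
  have hinter := Finset.card_union_add_card_inter Q Q'
  obtain ⟨r, hr, hrB⟩ : ∃ r ∈ Q ∩ Q', r ∉ B :=
    Finset.exists_mem_notMem_of_card_lt_card (by omega)
  obtain ⟨hrQ, hrQ'⟩ := Finset.mem_inter.mp hr
  exact Finset.mem_biUnion.mpr ⟨r, hrQ', hmono r (hQR hrQ) hrB (hstored r hrQ hrB)⟩
end

section
/- Let α be a type, v : α → ℝ with v x ≥ 0 for all x, and k a natural number. For each i ∈ {1, …, k}, let D_i, P_i, C_i be finite subsets of α such that D_i ⊆ P_i and ∑_{x ∈ P_i} v x ≤ ∑_{x ∈ C_i} v x, and suppose the sets P_1, …, P_k are pairwise comparable under inclusion. Then ∑_{x ∈ ⋃_i D_i} v x ≤ ∑_{x ∈ ⋃_i C_i} v x. -/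
theorem accepted_debits_covered {α : Type*} [DecidableEq α]
    (v : α → ℝ) (hv : ∀ x, v x ≥ 0) (k : ℕ)
    (D P C : Fin k → Finset α)
    (hDP : ∀ i, D i ⊆ P i)
    (hPC : ∀ i, ∑ x ∈ P i, v x ≤ ∑ x ∈ C i, v x)
    (hcomp : ∀ i j, P i ⊆ P j ∨ P j ⊆ P i) :
    ∑ x ∈ Finset.univ.biUnion D, v x ≤ ∑ x ∈ Finset.univ.biUnion C, v x := by
  rcases isEmpty_or_nonempty (Fin k) with _ | _
  · simp
  obtain ⟨m, hm⟩ : ∃ m, ∀ i, P i ⊆ P m := by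
    obtain ⟨m, -, hm⟩ := Finset.exists_max_image Finset.univ (fun i => (P i).card)
      Finset.univ_nonempty
    refine ⟨m, fun i => (hcomp i m).elim id fun h => ?_⟩
    exact (Finset.eq_of_subset_of_card_le h (hm i (Finset.mem_univ i))).ge
  calc ∑ x ∈ Finset.univ.biUnion D, v x
      ≤ ∑ x ∈ P m, v x :=
        Finset.sum_le_sum_of_subset_of_nonneg
          (Finset.biUnion_subset.2 fun i _ => (hDP i).trans (hm i)) fun x _ _ => hv x
    _ ≤ ∑ x ∈ C m, v x := hPC m
    _ ≤ ∑ x ∈ Finset.univ.biUnion C, v x :=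
        Finset.sum_le_sum_of_subset_of_nonneg
          (Finset.subset_biUnion_of_mem C (Finset.mem_univ m)) fun x _ _ => hv x
end
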